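/- For n > 1 with prime factorization n = ∏ p_i^{k_i} and d ≥ 1, the number of separable polynomials f ∈ (ℤ/n)[x] with deg(f) ≤ d is φ(n)·n^d·∏_i(1 + p_i^{-d}). -/

import Mathlib

open TensorProduct Polynomial

/-- An `R`-algebra `A` is separable if `A` is projective as a module over the
enveloping algebra `A ⊗[R] A` (for commutative `A`, which acts via multiplication). -/
def IsSeparableAlgebra (R A : Type*) [CommRing R] [CommRing A] [Algebra R A] : Prop :=
  letI : Module (A ⊗[R] A) A :=
    Module.compHom A (Algebra.TensorProduct.lmul' (S := A) R).toRingHom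
  Module.Projective (A ⊗[R] A) A

/-- A polynomial `f ∈ R[x]` is separable if `R[x]/(f)` is a separable `R`-algebra. -/
def Polynomial.IsSeparablePoly {R : Type*} [CommRing R] (f : R[X]) : Prop :=
  IsSeparableAlgebra R (AdjoinRoot f)

theorem isSeparableAlgebra_iff_exists_tensorProduct (R A : Type*) [CommRing R] [CommRing A]
    [Algebra R A] :
    IsSeparableAlgebra R A ↔ ∃ t : A ⊗[R] A,
      (∀ a, ((1 : A) ⊗ₜ[R] a - a ⊗ₜ[R] (1 : A)) * t = 0) ∧
        Algebra.TensorProduct.lmul' R t = 1 := by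
  let : Module (A ⊗[R] A) A :=
    Module.compHom A (Algebra.TensorProduct.lmul' (S := A) R).toRingHom
  have smul_def (z : A ⊗[R] A) (a : A) : z • a = Algebra.TensorProduct.lmul' R z * a := rfl
  change Module.Projective (A ⊗[R] A) A ↔ _
  let μ : A ⊗[R] A →ₗ[A ⊗[R] A] A := LinearMap.toSpanSingleton _ _ 1
  have μ_apply (z : A ⊗[R] A) : μ z = Algebra.TensorProduct.lmul' R z := by
    simp [μ, LinearMap.toSpanSingleton_apply, smul_def]
  constructor
  · intro h
    obtain ⟨s, hs⟩ := Module.projective_lifting_property μ LinearMap.id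
      (fun a ↦ ⟨a ⊗ₜ 1, by simp [μ_apply]⟩)
    refine ⟨s 1, fun a ↦ ?_, ?_⟩
    · rw [← smul_eq_mul, ← map_smul, smul_def]
      simp
    · rw [← μ_apply]
      exact LinearMap.congr_fun hs 1
  · rintro ⟨t, ht, ht1⟩
    have key (z : A ⊗[R] A) : (Algebra.TensorProduct.lmul' R z ⊗ₜ[R] (1 : A)) * t = z * t := by
      induction z with
      | zero => simp
      | add x y hx hy => rw [map_add, TensorProduct.add_tmul, add_mul, add_mul, hx, hy]
      | tmul x y =>
        have h := ht y
        rw [sub_mul, sub_eq_zero] at h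
        calc _ = (x ⊗ₜ[R] (1 : A)) * ((y ⊗ₜ[R] (1 : A)) * t) := by
              rw [← mul_assoc]; simp
          _ = _ := by rw [← h, ← mul_assoc]; simp
    let s : A →ₗ[A ⊗[R] A] A ⊗[R] A :=
      { toFun a := (a ⊗ₜ 1) * t
        map_add' a b := by rw [TensorProduct.add_tmul, add_mul]
        map_smul' z a := by
          rw [smul_def, RingHom.id_apply, smul_eq_mul, ← mul_assoc]
          have := key (z * (a ⊗ₜ 1))
          simpa using this }
    refine Module.Projective.of_split s μ (LinearMap.ext fun a ↦ ?_)
    simp [s, μ_apply, ht1]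

theorem isSeparableAlgebra_iff_formallyUnramified (R A : Type*) [CommRing R] [CommRing A]
    [Algebra R A] [Algebra.EssFiniteType R A] :
    IsSeparableAlgebra R A ↔ Algebra.FormallyUnramified R A := by
  rw [isSeparableAlgebra_iff_exists_tensorProduct,
    Algebra.FormallyUnramified.iff_exists_tensorProduct]

theorem Polynomial.one_eq_zero_of_aeval_derivative_eq_zero {R B : Type*} [CommRing R] [CommRing B]
    [Algebra R B] (f : R[X]) [Algebra.FormallyUnramified R (AdjoinRoot f)] (b : B)
    (hf : aeval b f = 0) (hf' : aeval b (derivative f) = 0) : (1 : B) = 0 := by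
  let x : DualNumber B := TrivSqZeroExt.inl b
  let ε : DualNumber B := DualNumber.eps
  have hx (g : R[X]) : aeval x g = TrivSqZeroExt.inl (aeval b g) :=
    aeval_algHom_apply (TrivSqZeroExt.inlAlgHom R B B) b g
  have h₁ : aeval x f = 0 := by rw [hx, hf, TrivSqZeroExt.inl_zero]
  have h₂ : aeval (x + ε) f = 0 := by
    rw [aeval_add_of_sq_eq_zero f x ε (by rw [sq]; exact DualNumber.eps_mul_eps), h₁, hx, hf',
      TrivSqZeroExt.inl_zero, zero_mul, add_zero]
  let g₁ : AdjoinRoot f →ₐ[R] DualNumber B := AdjoinRoot.liftAlgHom f (Algebra.ofId R _) x h₁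
  let g₂ : AdjoinRoot f →ₐ[R] DualNumber B :=
    AdjoinRoot.liftAlgHom f (Algebra.ofId R _) (x + ε) h₂
  have hg₁ : g₁ (AdjoinRoot.root f) = x := AdjoinRoot.liftAlgHom_root ..
  have hg₂ : g₂ (AdjoinRoot.root f) = x + ε := AdjoinRoot.liftAlgHom_root ..
  have hfst : (TrivSqZeroExt.fstHom R B B).comp g₁ = (TrivSqZeroExt.fstHom R B B).comp g₂ :=
    AdjoinRoot.algHom_ext (by
      rw [AlgHom.comp_apply, AlgHom.comp_apply, hg₁, hg₂]
      simp [ε])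
  have heq : g₁ = g₂ := by
    refine Algebra.FormallyUnramified.ext (TrivSqZeroExt.kerIdeal B B)
      ⟨2, TrivSqZeroExt.kerIdeal_sq B B⟩ fun a ↦ ?_
    rw [Ideal.Quotient.eq]
    change (g₁ a - g₂ a).fst = 0
    rw [TrivSqZeroExt.fst_sub, sub_eq_zero]
    exact DFunLike.congr_fun hfst a
  have hε : x + ε = x := by rw [← hg₂, ← heq, hg₁]
  simpa [x, ε] using congrArg TrivSqZeroExt.snd hε

theorem Polynomial.formallyUnramified_adjoinRoot_iff_separable {R : Type*} [CommRing R]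
    (f : R[X]) : Algebra.FormallyUnramified R (AdjoinRoot f) ↔ f.Separable := by
  constructor
  · intro h
    let J : Ideal R[X] := Ideal.span {f, derivative f}
    let b : R[X] ⧸ J := Ideal.Quotient.mk J X
    have haeval (g : R[X]) : aeval b g = Ideal.Quotient.mk J g := by
      have : b = Ideal.Quotient.mkₐ R J X := rfl
      rw [this, aeval_algHom_apply, aeval_X_left_apply]
      rfl
    have hf : aeval b f = 0 := by
      rw [haeval, Ideal.Quotient.eq_zero_iff_mem]
      exact Ideal.subset_span (by simp)
    have hf' : aeval b (derivative f) = 0 := by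
      rw [haeval, Ideal.Quotient.eq_zero_iff_mem]
      exact Ideal.subset_span (by simp)
    have h10 : (1 : R[X] ⧸ J) = 0 := one_eq_zero_of_aeval_derivative_eq_zero f b hf hf'
    rw [← map_one (Ideal.Quotient.mk J), Ideal.Quotient.eq_zero_iff_mem,
      Ideal.mem_span_pair] at h10
    exact h10
  · rintro ⟨u, v, huv⟩
    rw [Algebra.formallyUnramified_iff]
    have hD (g : R[X]) : KaehlerDifferential.D R (AdjoinRoot f) (aeval (AdjoinRoot.root f) g) =
        aeval (AdjoinRoot.root f) (derivative g) •
          KaehlerDifferential.D R (AdjoinRoot f) (AdjoinRoot.root f) :=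
      Derivation.map_aeval _ _ _
    have hroot : KaehlerDifferential.D R (AdjoinRoot f) (AdjoinRoot.root f) = 0 := by
      have h0 := hD f
      have h1 := congrArg (aeval (AdjoinRoot.root f)) huv
      simp only [AdjoinRoot.aeval_eq, AdjoinRoot.mk_self, map_zero, map_add, map_mul, mul_zero,
        zero_add, map_one] at h0 h1
      rw [← one_smul (AdjoinRoot f) (KaehlerDifferential.D R (AdjoinRoot f) _), ← h1, mul_smul,
        ← h0, smul_zero]
    rw [← Submodule.subsingleton_iff (AdjoinRoot f), ← subsingleton_iff_bot_eq_top,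
      ← KaehlerDifferential.span_range_derivation, eq_comm, Submodule.span_eq_bot]
    rintro _ ⟨a, rfl⟩
    obtain ⟨g, rfl⟩ := AdjoinRoot.mk_surjective a
    rw [← AdjoinRoot.aeval_eq, hD, hroot, smul_zero]

theorem Polynomial.isSeparablePoly_iff_separable {R : Type*} [CommRing R] (f : R[X]) :
    f.IsSeparablePoly ↔ f.Separable := by
  have : Algebra.FiniteType R (AdjoinRoot f) := inferInstance
  rw [IsSeparablePoly, isSeparableAlgebra_iff_formallyUnramified,
    formallyUnramified_adjoinRoot_iff_separable]

theorem Polynomial.Separable.of_map_castHom {ι : Type*} [Fintype ι] {p k : ι → ℕ} {n : ℕ}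
    (hn : n = ∏ i, p i ^ k i) (hdvd : ∀ i, p i ∣ n) {f : (ZMod n)[X]}
    (h : ∀ i, (f.map (ZMod.castHom (hdvd i) (ZMod (p i)))).Separable) : f.Separable := by
  suffices hI : Ideal.span {f, derivative f} = ⊤ by
    have h1 : (1 : (ZMod n)[X]) ∈ Ideal.span {f, derivative f} := hI ▸ Submodule.mem_top
    rwa [Ideal.mem_span_pair] at h1
  by_contra hI
  obtain ⟨M, hM, hle⟩ := Ideal.exists_le_maximal _ hI
  have hprod : ∏ i, ((p i : ℕ) : (ZMod n)[X]) ^ k i ∈ M := by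
    have : ((∏ i, p i ^ k i : ℕ) : (ZMod n)[X]) = 0 := by rw [← hn]; simp
    push_cast at this
    rw [this]
    exact M.zero_mem
  obtain ⟨i, -, hi⟩ := hM.isPrime.prod_mem_iff.1 hprod
  have hi := hM.isPrime.mem_of_pow_mem _ hi
  set φ := ZMod.castHom (hdvd i) (ZMod (p i)) with hφ
  have hker (g : (ZMod n)[X]) (hg : g.map φ = 0) : g ∈ M := by
    have : C ((p i : ℕ) : ZMod n) ∣ g := by
      rw [C_dvd_iff_dvd_coeff]
      intro m
      have hm : φ (g.coeff m) = 0 := by rw [← coeff_map, hg, coeff_zero]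
      obtain ⟨z, hz⟩ := ZMod.intCast_surjective (g.coeff m)
      rw [← hz] at hm ⊢
      rw [map_intCast, ZMod.intCast_zmod_eq_zero_iff_dvd] at hm
      simpa using (Int.castRingHom (ZMod n)).map_dvd hm
    obtain ⟨u, rfl⟩ := this
    exact M.mul_mem_right _ (by simpa using hi)
  obtain ⟨a, b, hab⟩ := h i
  have hsurj := map_surjective φ (ZMod.castHom_surjective (hdvd i))
  obtain ⟨a, rfl⟩ := hsurj a
  obtain ⟨b, rfl⟩ := hsurj b
  have h1 : 1 - (a * f + b * derivative f) ∈ M := hker _ (by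
    rw [derivative_map, ← hφ] at hab
    simp [hab, Polynomial.map_sub])
  have h2 : a * f + b * derivative f ∈ M :=
    M.add_mem (M.mul_mem_left _ (hle (Ideal.subset_span (by simp))))
      (M.mul_mem_left _ (hle (Ideal.subset_span (by simp))))
  exact hM.ne_top ((Ideal.eq_top_iff_one M).2 (by simpa using M.add_mem h1 h2))

theorem AddMonoidHom.card_preimage_mul_card {G H : Type*} [AddGroup G] [AddGroup H] (φ : G →+ H)
    (hφ : Function.Surjective φ) (T : Set H) :
    Nat.card (φ ⁻¹' T) * Nat.card H = Nat.card G * Nat.card T := by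
  have h (T : Set H) : Nat.card (φ ⁻¹' T) = Nat.card φ.ker * Nat.card T := by
    choose s hs using hφ
    rw [← Nat.card_prod]
    refine Nat.card_congr
      { toFun x := (⟨x - s (φ x), by simp [AddMonoidHom.mem_ker, hs]⟩, ⟨φ x, x.2⟩)
        invFun y := ⟨y.1 + s y.2, by
          have := AddMonoidHom.mem_ker.1 y.1.2
          simp [hs, this]⟩
        left_inv x := by simp
        right_inv y := by
          have := AddMonoidHom.mem_ker.1 y.1.2
          ext <;> simp [hs, this] }
  have hG := h Set.univ
  rw [Set.preimage_univ, Nat.card_univ, Nat.card_univ] at hG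
  rw [h T, hG]
  ring

/-- Polynomials of degree at most `d` correspond to their coefficient vectors. -/
noncomputable def Polynomial.natDegreeLEEquiv (R : Type*) [Semiring R] (d : ℕ) :
    {f : R[X] // f.natDegree ≤ d} ≃ (Fin (d + 1) → R) where
  toFun f i := f.1.coeff i
  invFun v := ⟨∑ i : Fin (d + 1), monomial i (v i),
    natDegree_sum_le_of_forall_le _ _ fun i _ ↦
      (natDegree_monomial_le _).trans (Nat.lt_succ_iff.1 i.2)⟩
  left_inv f := by
    ext1
    dsimp only
    rw [Fin.sum_univ_eq_sum_range fun i ↦ monomial i (f.1.coeff i)]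
    exact (f.1.as_sum_range' _ (Nat.lt_succ_iff.2 f.2)).symm
  right_inv v := by
    ext i
    simp [coeff_monomial, Fin.val_inj]

theorem Polynomial.card_natDegree_le_and (R : Type*) [Semiring R] (d : ℕ) (P : R[X] → Prop) :
    Nat.card {f : R[X] | f.natDegree ≤ d ∧ P f} =
      Nat.card {v | P ((natDegreeLEEquiv R d).symm v).1} :=
  Nat.card_congr ((Equiv.subtypeSubtypeEquivSubtypeInter _ P).symm.trans
    ((natDegreeLEEquiv R d).subtypeEquiv fun f ↦ by simp))

theorem ZMod.pi_castHom_surjective {ι : Type*} [Fintype ι] {p : ι → ℕ} {n : ℕ}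
    (hp : ∀ i, (p i).Prime) (hinj : Function.Injective p) (hdvd : ∀ i, p i ∣ n) :
    Function.Surjective fun (x : ZMod n) i ↦ ZMod.castHom (hdvd i) (ZMod (p i)) x := by
  have hcop : Pairwise (Function.onFun Nat.Coprime p) := fun i j hij ↦
    (Nat.coprime_primes (hp i) (hp j)).2 (hinj.ne hij)
  intro y
  have hprod : ∏ i, p i ∣ n :=
    Fintype.prod_dvd_of_isRelPrime (fun i j hij ↦ Nat.coprime_iff_isRelPrime.1 (hcop hij)) hdvd
  obtain ⟨z, rfl⟩ := (ZMod.prodEquivPi p hcop).surjective y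
  obtain ⟨x, rfl⟩ := ZMod.castHom_surjective hprod z
  refine ⟨x, funext fun i ↦ ?_⟩
  rw [ZMod.prodEquivPi_apply, ← RingHom.comp_apply]
  exact RingHom.congr_fun (RingHom.ext_zmod _ _) x

theorem Polynomial.card_separable_natDegree_le_zmod {ι : Type*} [Fintype ι] {p k : ι → ℕ}
    {n : ℕ} (d : ℕ) (hp : ∀ i, (p i).Prime) (hinj : Function.Injective p)
    (hn : n = ∏ i, p i ^ k i) (hdvd : ∀ i, p i ∣ n) :
    Nat.card {f : (ZMod n)[X] | f.natDegree ≤ d ∧ f.Separable} * ∏ i, p i ^ (d + 1) =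
      n ^ (d + 1) * ∏ i, Nat.card {f : (ZMod (p i))[X] | f.natDegree ≤ d ∧ f.Separable} := by
  let φ : (Fin (d + 1) → ZMod n) →+ (∀ i, Fin (d + 1) → ZMod (p i)) :=
    { toFun v i m := ZMod.castHom (hdvd i) (ZMod (p i)) (v m)
      map_zero' := by ext; simp
      map_add' v w := by
        funext i m
        exact map_add (ZMod.castHom (hdvd i) (ZMod (p i))) (v m) (w m) }
  have hφ : Function.Surjective φ := by
    intro w
    choose v hv using fun m : Fin (d + 1) ↦ ZMod.pi_castHom_surjective hp hinj hdvd fun i ↦ w i m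
    exact ⟨v, by ext i m; exact congrFun (hv m) i⟩
  let S (i : ι) : Set (Fin (d + 1) → ZMod (p i)) :=
    {v | ((natDegreeLEEquiv _ d).symm v).1.Separable}
  have hpre : {v | ((natDegreeLEEquiv (ZMod n) d).symm v).1.Separable} =
      φ ⁻¹' Set.univ.pi S := by
    ext v
    have hmap (i : ι) : ((natDegreeLEEquiv _ d).symm (φ v i)).1 =
        ((natDegreeLEEquiv _ d).symm v).1.map (ZMod.castHom (hdvd i) (ZMod (p i))) := by
      simp [natDegreeLEEquiv, φ, Polynomial.map_sum]
    simp only [Set.mem_ofPred_eq, Set.mem_preimage, Set.mem_univ_pi, S, hmap]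
    exact ⟨fun h i ↦ h.map, fun h ↦ .of_map_castHom hn hdvd h⟩
  have hS : Nat.card (Set.univ.pi S) = ∏ i, Nat.card (S i) := by
    rw [← Nat.card_pi]
    exact Nat.card_congr (Equiv.Set.univPi S)
  have hcard := φ.card_preimage_mul_card hφ (Set.univ.pi S)
  rw [← hpre, hS, Nat.card_pi] at hcard
  simp only [card_natDegree_le_and]
  simpa [S, Nat.card_fun] using hcard

theorem Polynomial.card_natDegree_le_and_ne_zero (K : Type*) [Semiring K] [Finite K] (d : ℕ) :
    Nat.card {f : K[X] | f.natDegree ≤ d ∧ f ≠ 0} + 1 = Nat.card K ^ (d + 1) := by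
  have h : {v | ((natDegreeLEEquiv K d).symm v).1 ≠ 0} = ({0} : Set (Fin (d + 1) → K))ᶜ := by
    have h0 : ((natDegreeLEEquiv K d).symm 0).1 = 0 := by simp [natDegreeLEEquiv]
    ext v
    simp only [Set.mem_ofPred_eq, Set.mem_compl_iff, Set.mem_singleton_iff, ne_eq]
    rw [← h0, Subtype.coe_inj, (natDegreeLEEquiv K d).symm.apply_eq_iff_eq]
  have hc := Set.ncard_add_ncard_compl ({0} : Set (Fin (d + 1) → K))
  rw [card_natDegree_le_and, h, Nat.card_coe_set_eq, add_comm]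
  simpa [Nat.card_fun] using hc

theorem Polynomial.card_monic_natDegree_eq (K : Type*) [CommRing K] [Nontrivial K] [Finite K]
    (d : ℕ) : Nat.card {f : K[X] | f.Monic ∧ f.natDegree = d} = Nat.card K ^ d := by
  have h := Nat.card_congr ((monicEquivDegreeLT d).trans (degreeLTEquiv K d).toEquiv)
  rw [Nat.card_fun, Nat.card_fin] at h
  exact h

theorem Polynomial.exists_squarefree_mul_monic_sq {K : Type*} [Field K] {f : K[X]} (hf : f ≠ 0) :
    ∃ a b : K[X], Squarefree a ∧ b.Monic ∧ a * b ^ 2 = f := by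
  induction hd : f.natDegree using Nat.strong_induction_on generalizing f with
  | h d ih =>
  subst hd
  by_cases hs : Squarefree f
  · exact ⟨f, 1, hs, monic_one, by simp⟩
  · simp only [Squarefree, not_forall] at hs
    obtain ⟨x, ⟨g, rfl⟩, hx⟩ := hs
    have hx0 : x ≠ 0 := by rintro rfl; simp at hf
    have hg0 : g ≠ 0 := by rintro rfl; simp at hf
    have hdx : 0 < x.natDegree :=
      natDegree_pos_iff_degree_pos.2 (degree_pos_of_ne_zero_of_nonunit hx0 hx)
    obtain ⟨a, b, ha, hb, rfl⟩ := ih g.natDegree (by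
      rw [natDegree_mul (mul_ne_zero hx0 hx0) hg0, natDegree_mul hx0 hx0]; omega) hg0 rfl
    have hl : x.leadingCoeff ≠ 0 := leadingCoeff_ne_zero.2 hx0
    refine ⟨C (x.leadingCoeff ^ 2) * a, x * C x.leadingCoeff⁻¹ * b, ?_,
      (monic_mul_leadingCoeff_inv hx0).mul hb, ?_⟩
    · exact (associated_unit_mul_left a _
        (isUnit_C.2 (pow_ne_zero 2 hl).isUnit)).squarefree_iff.2 ha
    · have : C (x.leadingCoeff) * C (x.leadingCoeff)⁻¹ = (1 : K[X]) := by
        rw [← C_mul, mul_inv_cancel₀ hl, C_1]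
      rw [C_pow]
      linear_combination (x ^ 2 * a * b ^ 2) *
        (C (x.leadingCoeff) * C (x.leadingCoeff)⁻¹ + 1) * this

theorem Polynomial.eq_of_squarefree_mul_monic_sq {K : Type*} [Field K] {a b a' b' : K[X]}
    (ha : Squarefree a) (ha' : Squarefree a') (hb : b.Monic) (hb' : b'.Monic)
    (h : a * b ^ 2 = a' * b' ^ 2) : b = b' := by
  have key {a b a' b' : K[X]} (ha' : Squarefree a') (hb : b ≠ 0)
      (h : a * b ^ 2 = a' * b' ^ 2) : b ∣ b' := by
    classical
    obtain ⟨β, β', g, hrel, rfl, rfl⟩ : ∃ β β' g : K[X], IsCoprime β β' ∧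
        b = g * β ∧ b' = g * β' := by
      obtain ⟨β, hβ⟩ := EuclideanDomain.gcd_dvd_left b b'
      obtain ⟨β', hβ'⟩ := EuclideanDomain.gcd_dvd_right b b'
      refine ⟨β, β', _, ?_, hβ, hβ'⟩
      have hg : EuclideanDomain.gcd b b' ≠ 0 := fun h0 ↦ hb (by rw [hβ, h0, zero_mul])
      have hbez := EuclideanDomain.gcd_eq_gcd_ab b b'
      refine ⟨EuclideanDomain.gcdA b b', EuclideanDomain.gcdB b b', mul_left_cancel₀ hg ?_⟩
      linear_combination -hbez - EuclideanDomain.gcdA b b' * hβ - EuclideanDomain.gcdB b b' * hβ'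
    have hg : g ≠ 0 := left_ne_zero_of_mul hb
    have h' : a * β ^ 2 = a' * β' ^ 2 := by
      apply mul_left_cancel₀ (pow_ne_zero 2 hg)
      linear_combination h
    have hdvd : β * β ∣ a' := by
      rw [← sq]
      exact (hrel.pow (m := 2) (n := 2)).dvd_of_dvd_mul_right ⟨a, by rw [← h']; ring⟩
    have hu := ha' β hdvd
    exact mul_dvd_mul_left g (hu.dvd)
  exact eq_of_monic_of_associated hb hb'
    (associated_of_dvd_dvd (key ha' hb.ne_zero h) (key ha hb'.ne_zero h.symm))

theorem Polynomial.finite_natDegree_le_and (R : Type*) [Semiring R] [Finite R] (d : ℕ)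
    (P : R[X] → Prop) : Finite {f : R[X] | f.natDegree ≤ d ∧ P f} :=
  have : Finite {f : R[X] // f.natDegree ≤ d} := .of_equiv _ (natDegreeLEEquiv R d).symm
  .of_injective (fun f ↦ (⟨f.1, f.2.1⟩ : {f : R[X] // f.natDegree ≤ d}))
    fun _ _ h ↦ Subtype.ext (Subtype.mk.inj h)

theorem Polynomial.sum_card_squarefree_natDegree_le (K : Type*) [Field K] [Finite K] (d : ℕ) :
    ∑ j ∈ Finset.range (d / 2 + 1),
      Nat.card K ^ j * Nat.card {f : K[X] | f.natDegree ≤ d - 2 * j ∧ Squarefree f} + 1 =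
        Nat.card K ^ (d + 1) := by
  have (j : ℕ) : Finite {f : K[X] | f.natDegree ≤ d - 2 * j ∧ Squarefree f} :=
    finite_natDegree_le_and ..
  have (j : ℕ) : Finite {f : K[X] | f.Monic ∧ f.natDegree = j} :=
    .of_equiv _ ((monicEquivDegreeLT j).trans (degreeLTEquiv K j).toEquiv).symm
  have hdeg {a b : K[X]} (ha : Squarefree a) (hb : b.Monic) :
      (a * b ^ 2).natDegree = a.natDegree + 2 * b.natDegree := by
    rw [natDegree_mul ha.ne_zero (pow_ne_zero 2 hb.ne_zero), natDegree_pow]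
  let F (x : Σ j : Fin (d / 2 + 1), {f : K[X] | f.Monic ∧ f.natDegree = j} ×
      {f : K[X] | f.natDegree ≤ d - 2 * j ∧ Squarefree f}) :
      {f : K[X] | f.natDegree ≤ d ∧ f ≠ 0} :=
    ⟨x.2.2.1 * x.2.1.1 ^ 2, by
      obtain ⟨j, ⟨b, hb, hbj⟩, ⟨a, had, ha⟩⟩ := x
      refine ⟨?_, mul_ne_zero ha.ne_zero (pow_ne_zero 2 hb.ne_zero)⟩
      simp only [hdeg ha hb]
      omega⟩
  have hF : F.Bijective := by
    constructor
    · rintro ⟨⟨i, hi⟩, ⟨b, hb, hbi⟩, ⟨a, had, ha⟩⟩ ⟨⟨j, hj⟩, ⟨b', hb', hbj⟩, ⟨a', had', ha'⟩⟩ h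
      have h : a * b ^ 2 = a' * b' ^ 2 := congrArg Subtype.val h
      obtain rfl := eq_of_squarefree_mul_monic_sq ha ha' hb hb' h
      obtain rfl := mul_right_cancel₀ (pow_ne_zero 2 hb.ne_zero) h
      dsimp only at hbi hbj
      obtain rfl := hbi.symm.trans hbj
      rfl
    · rintro ⟨f, hfd, hf⟩
      obtain ⟨a, b, ha, hb, rfl⟩ := exists_squarefree_mul_monic_sq hf
      rw [hdeg ha hb] at hfd
      exact ⟨⟨⟨b.natDegree, by omega⟩, ⟨b, hb, rfl⟩, ⟨a, by dsimp only; omega, ha⟩⟩, rfl⟩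
  rw [← card_natDegree_le_and_ne_zero, ← Nat.card_congr (Equiv.ofBijective F hF), Nat.card_sigma,
    Finset.sum_range]
  simp only [Nat.card_prod, card_monic_natDegree_eq]

theorem Polynomial.card_squarefree_natDegree_le (K : Type*) [Field K] [Finite K] {d : ℕ}
    (hd : 1 ≤ d) : (Nat.card {f : K[X] | f.natDegree ≤ d ∧ Squarefree f} : ℚ) =
      (Nat.card K - 1) * (Nat.card K ^ d + 1) := by
  have h := sum_card_squarefree_natDegree_le K d
  rw [Finset.sum_range_succ'] at h
  obtain rfl | ⟨e, rfl⟩ : d = 1 ∨ ∃ e, d = e + 2 := by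
    rcases d with _ | _ | e
    · omega
    · simp
    · exact .inr ⟨e, rfl⟩
  · norm_num at h
    rw [Nat.card_coe_set_eq]
    have h : (_ : ℚ) = _ := congrArg Nat.cast h
    push_cast at h
    linear_combination h
  · have h' := sum_card_squarefree_natDegree_le K e
    rw [show (e + 2) / 2 = e / 2 + 1 by omega] at h
    have hs (j : ℕ) : e + 2 - 2 * (j + 1) = e - 2 * j := by omega
    simp only [hs, pow_succ', mul_assoc, ← Finset.mul_sum] at h h'
    have h : (_ : ℚ) = _ := congrArg Nat.cast h
    have h' : (_ : ℚ) = _ := congrArg Nat.cast h'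
    push_cast at h h'
    simp only [pow_zero, one_mul] at h
    linear_combination h - Nat.card K * h'

theorem Polynomial.card_separable_natDegree_le (K : Type*) [Field K] [Finite K] {d : ℕ}
    (hd : 1 ≤ d) : (Nat.card {f : K[X] | f.natDegree ≤ d ∧ f.Separable} : ℚ) =
      (Nat.card K - 1) * (Nat.card K ^ d + 1) := by
  simp only [PerfectField.separable_iff_squarefree, card_squarefree_natDegree_le K hd]

/-- For `n = ∏ pᵢ^kᵢ > 1` and `d ≥ 1`, the number of separable polynomials over `ℤ/n` of
degree at most `d` is `φ(n)·n^d·∏ᵢ(1 + pᵢ^(-d))`. -/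
theorem count_separable_deg_le_zmod_n {ι : Type*} [Fintype ι] (p k : ι → ℕ)
    (hp : ∀ i, (p i).Prime) (hinj : Function.Injective p) (hk : ∀ i, 1 ≤ k i)
    (n d : ℕ) (hn : n = ∏ i, p i ^ k i) (hn1 : 1 < n) (hd : 1 ≤ d) :
    (Nat.card {f : (ZMod n)[X] | f.natDegree ≤ d ∧ f.IsSeparablePoly} : ℚ)
      = Nat.totient n * (n : ℚ) ^ d * ∏ i, (1 + ((p i : ℚ))⁻¹ ^ d) := by
  simp only [isSeparablePoly_iff_separable]
  have hdvd (i : ι) : p i ∣ n :=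
    (dvd_pow_self _ (Nat.one_le_iff_ne_zero.1 (hk i))).trans
      (hn ▸ Finset.dvd_prod_of_mem _ (Finset.mem_univ i))
  have hprime : n.primeFactors = Finset.univ.image p := by
    ext q
    simp only [Nat.mem_primeFactors, Finset.mem_image, Finset.mem_univ, true_and]
    constructor
    · rintro ⟨hq, hqn, -⟩
      rw [hn, hq.prime.dvd_finsetProd_iff] at hqn
      obtain ⟨i, -, hi⟩ := hqn
      exact ⟨i, ((Nat.prime_dvd_prime_iff_eq hq (hp i)).1 (hq.dvd_of_dvd_pow hi)).symm⟩
    · rintro ⟨i, rfl⟩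
      exact ⟨hp i, hdvd i, by omega⟩
  have htot : (Nat.totient n : ℚ) = n * ∏ i, (1 - (p i : ℚ)⁻¹) := by
    rw [Nat.totient_eq_mul_prod_factors, hprime, Finset.prod_image hinj.injOn]
  have hcard (i : ι) : (Nat.card {f : (ZMod (p i))[X] | f.natDegree ≤ d ∧ f.Separable} : ℚ) =
      (p i - 1) * (p i ^ d + 1) := by
    have : Fact (p i).Prime := ⟨hp i⟩
    rw [card_separable_natDegree_le _ hd, Nat.card_zmod]
  have hp0 (i : ι) : (p i : ℚ) ≠ 0 := Nat.cast_ne_zero.2 (hp i).ne_zero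
  have h : (_ : ℚ) = _ :=
    congrArg Nat.cast (card_separable_natDegree_le_zmod d hp hinj hn hdvd)
  push_cast at h
  simp only [hcard] at h
  apply mul_right_cancel₀ (Finset.prod_ne_zero_iff.2 fun i _ ↦ pow_ne_zero (d + 1) (hp0 i))
  rw [h, htot, pow_succ, mul_comm _ (n : ℚ)]
  simp only [mul_assoc, mul_left_comm _ ((n : ℚ) ^ d), ← Finset.prod_mul_distrib]
  congr! 3 with i
  have := hp0 i
  rw [inv_pow]
  field_simp
  ring
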